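/- Let p be a prime and n ≥ 1 (with n ≥ 2 if p = 2). For every ν ∈ ℕ, if one writes the polynomial p^{nν}·binom(T,ν) ∈ ℚ_p[T] in the form Σ_{j=0}^{ν} c_{ν,j}·(p^n T)^j/j!, then all the coefficients c_{ν,j} lie in ℤ_p. -/

import Mathlib

open Polynomial

lemma aux_dvd (p : ℕ) [Fact p.Prime] (k : ℕ) :
    ((k + 1 : ℕ) : ℤ_[p]) ∣ (p : ℤ_[p]) ^ k := by
  have hp : p.Prime := Fact.out
  obtain ⟨v, u, hu, h⟩ := Nat.exists_eq_pow_mul_and_not_dvd (Nat.succ_ne_zero k) p hp.ne_one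
  have hunit : IsUnit (u : ℤ_[p]) := by
    rw [PadicInt.isUnit_iff, PadicInt.norm_natCast_eq_one_iff]
    exact (Nat.Prime.coprime_iff_not_dvd hp).2 hu
  have hv : v ≤ k := by
    have h1 : v < p ^ v := Nat.lt_pow_self hp.one_lt
    have h2 : p ^ v ≤ k + 1 := Nat.le_of_dvd (Nat.succ_pos k) ⟨u, h⟩
    omega
  have h' : k + 1 = p ^ v * u := h
  rw [h']
  push_cast
  rw [hunit.mul_right_dvd]
  exact pow_dvd_pow _ hv

lemma aux_series (p : ℕ) [Fact p.Prime] : ∃ M : PowerSeries ℤ_[p],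
    PowerSeries.coeff 0 M = 0 ∧
    (1 + PowerSeries.C (p : ℤ_[p]) * PowerSeries.X) * PowerSeries.derivative ℤ_[p] M = 1 := by
  have h : ∀ k : ℕ, ∃ m : ℤ_[p], m * ((k : ℤ_[p]) + 1) = (-(p : ℤ_[p])) ^ k := by
    intro k
    obtain ⟨m, hm⟩ := aux_dvd p k
    refine ⟨(-1) ^ k * m, ?_⟩
    rw [neg_pow (p : ℤ_[p]), hm]
    push_cast
    ring
  choose m hm using h
  refine ⟨PowerSeries.mk fun k => if k = 0 then 0 else m (k - 1), by simp, ?_⟩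
  ext i
  rw [add_mul, one_mul, map_add, mul_assoc, PowerSeries.coeff_C_mul]
  cases i with
  | zero => simp [PowerSeries.coeff_derivative, PowerSeries.coeff_zero_X_mul] ; simpa using hm 0
  | succ i =>
    have h1 := hm i
    have h2 := hm (i + 1)
    rw [PowerSeries.coeff_succ_X_mul]
    simp only [PowerSeries.coeff_derivative, PowerSeries.coeff_mk, PowerSeries.coeff_one]
    simp only [Nat.add_eq_zero_iff, one_ne_zero, and_false, if_false, Nat.add_sub_cancel]
    rw [h1, h2]
    ring

lemma aux_rec (p : ℕ) [Fact p.Prime] (M : PowerSeries ℤ_[p])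
    (hM : (1 + PowerSeries.C (p : ℤ_[p]) * PowerSeries.X) * PowerSeries.derivative ℤ_[p] M = 1)
    (ν j : ℕ) :
    ((ν : ℤ_[p]) + 1) * PowerSeries.coeff (ν + 1) (M ^ (j + 1)) +
      p * ν * PowerSeries.coeff ν (M ^ (j + 1)) = (j + 1) * PowerSeries.coeff ν (M ^ j) := by
  have h : (1 + PowerSeries.C (p : ℤ_[p]) * PowerSeries.X) *
      PowerSeries.derivative ℤ_[p] (M ^ (j + 1)) = PowerSeries.C ((j : ℤ_[p]) + 1) * M ^ j := by
    rw [Derivation.leibniz_pow]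
    simp only [Nat.add_sub_cancel, nsmul_eq_mul, smul_eq_mul, map_add, map_one, map_natCast,
      Nat.cast_add, Nat.cast_one] at hM ⊢
    linear_combination ((j : PowerSeries ℤ_[p]) + 1) * M ^ j * hM
  have h2 := congrArg (PowerSeries.coeff ν) h
  rw [add_mul, one_mul, map_add, mul_assoc, PowerSeries.coeff_C_mul, PowerSeries.coeff_C_mul,
    PowerSeries.coeff_derivative] at h2
  rw [← h2]
  cases ν with
  | zero => simp [PowerSeries.coeff_zero_X_mul]
  | succ ν =>
    rw [PowerSeries.coeff_succ_X_mul, PowerSeries.coeff_derivative]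
    push_cast
    ring

lemma aux_coeff (p : ℕ) [Fact p.Prime] (M : PowerSeries ℤ_[p])
    (h0 : PowerSeries.coeff 0 M = 0)
    (hM : (1 + PowerSeries.C (p : ℤ_[p]) * PowerSeries.X) * PowerSeries.derivative ℤ_[p] M = 1)
    (ν : ℕ) : ∀ j : ℕ,
    (descPochhammer ℚ_[p] ν).coeff j * j.factorial * (p : ℚ_[p]) ^ ν =
      ν.factorial * (p : ℚ_[p]) ^ j * ((PowerSeries.coeff ν (M ^ j) : ℤ_[p]) : ℚ_[p]) := by
  induction ν with
  | zero =>
    intro j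
    rw [PowerSeries.coeff_zero_eq_constantCoeff_apply] at h0
    cases j with
    | zero => simp
    | succ j => simp [h0, Polynomial.coeff_one]
  | succ ν ih =>
    intro j
    cases j with
    | zero =>
      have : (descPochhammer ℚ_[p] (ν + 1)).coeff 0 = 0 := by
        rw [descPochhammer_succ_left]; simp
      simp [this, PowerSeries.coeff_one]
    | succ j =>
      have h1 := ih j
      have h2 := ih (j + 1)
      have h3 := congrArg (fun x : ℤ_[p] => (x : ℚ_[p])) (aux_rec p M hM ν j)
      push_cast at h3
      have h4 : (descPochhammer ℚ_[p] (ν + 1)).coeff (j + 1) =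
          (descPochhammer ℚ_[p] ν).coeff j - ν * (descPochhammer ℚ_[p] ν).coeff (j + 1) := by
        rw [descPochhammer_succ_right, mul_sub, Polynomial.coeff_sub, Polynomial.coeff_mul_X,
          Polynomial.coeff_mul_natCast]
        ring
      rw [h4]
      simp only [Nat.factorial_succ] at h2 ⊢
      push_cast at h1 h2 ⊢
      linear_combination ((j : ℚ_[p]) + 1) * p * h1 - ν * p * h2
        - ν.factorial * (p : ℚ_[p]) ^ (j + 1) * h3

theorem padic_binomial_coeffs_integral (p : ℕ) [Fact p.Prime] (n : ℕ)
    (hn : 1 ≤ n) (hp2 : p = 2 → 2 ≤ n) (ν : ℕ) :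
    ∃ c : ℕ → ℤ_[p],
      (p : ℚ_[p]) ^ (n * ν) • ((ν.factorial : ℚ_[p])⁻¹ • descPochhammer ℚ_[p] ν) =
        ∑ j ∈ Finset.range (ν + 1),
          (((c j : ℚ_[p]) / (j.factorial : ℚ_[p])) • ((p : ℚ_[p]) ^ n • X) ^ j) := by
  obtain ⟨M, h0, hM⟩ := aux_series p
  refine ⟨fun j => (p : ℤ_[p]) ^ ((n - 1) * (ν - j)) * PowerSeries.coeff ν (M ^ j), ?_⟩
  ext i
  simp only [Polynomial.finsetSum_coeff, Polynomial.coeff_smul, _root_.smul_pow, smul_eq_mul,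
    Polynomial.coeff_X_pow, mul_ite, mul_one, mul_zero]
  rw [Finset.sum_ite_eq]
  split_ifs with hi
  · have h := aux_coeff p M h0 hM ν i
    have hp : (p : ℚ_[p]) ≠ 0 := by exact_mod_cast (Fact.out : p.Prime).ne_zero
    have hf : (ν.factorial : ℚ_[p]) ≠ 0 := by exact_mod_cast ν.factorial_ne_zero
    have hg : (i.factorial : ℚ_[p]) ≠ 0 := by exact_mod_cast i.factorial_ne_zero
    obtain ⟨d, rfl⟩ : ∃ d, ν = i + d := ⟨ν - i, by have := Finset.mem_range.1 hi; omega⟩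
    obtain ⟨n, rfl⟩ : ∃ m, n = m + 1 := ⟨n - 1, by omega⟩
    push_cast
    simp only [Nat.add_sub_cancel, Nat.add_sub_cancel_left]
    field_simp
    apply mul_right_cancel₀ (pow_ne_zero (i + d) hp)
    have e1 : (p : ℚ_[p]) ^ ((n + 1) * (i + d)) =
      (p : ℚ_[p]) ^ (n * d) * (p : ℚ_[p]) ^ (n * i) * (p : ℚ_[p]) ^ (i + d) := by ring
    have e2 : ((p : ℚ_[p]) ^ (n + 1)) ^ i = (p : ℚ_[p]) ^ (n * i) * (p : ℚ_[p]) ^ i := by ring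
    simp only [e1, e2, ← pow_mul] at *
    linear_combination (p : ℚ_[p]) ^ (n * d) * (p : ℚ_[p]) ^ (n * i) * (p : ℚ_[p]) ^ (i + d) * h
  · rw [Polynomial.coeff_eq_zero_of_natDegree_lt]
    · simp
    · rw [descPochhammer_natDegree]
      simp at hi
      omega
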